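/- Let n, m ≥ 1 be integers and let k = (k_1,…,k_n) be a weight vector. For any n×m real matrix L belonging to Bad(k,n,m), the set Bad_L(k,n,m) has full Hausdorff dimension n. (In the paper this is deduced from the stronger assertion that Bad_L(k,n,m) is 1/2-winning for Schmidt's game.) -/

import Mathlib

/-- Distance from a real number to the nearest integer. -/
noncomputable def dni (x : ℝ) : ℝ := |x - round x|

/-- Supremum norm of an integer vector, as a real number. -/
noncomputable def snorm {d : ℕ} (q : Fin d → ℤ) : ℝ := ⨆ i, |(q i : ℝ)|

/-- Euclidean norm of an integer vector. -/
noncomputable def enorm {d : ℕ} (u : Fin d → ℤ) : ℝ := Real.sqrt (∑ j, ((u j : ℝ)) ^ 2)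

/-- `L ∈ Bad(k, n, m)`:  inf over nonzero integer vectors `q` of
`max_j |q|_∞^{m k_j} ‖L_j(q)‖` is positive. -/
def badForm {n m : ℕ} (k : Fin n → ℝ) (L : Matrix (Fin n) (Fin m) ℝ) : Prop :=
  ∃ ε > (0 : ℝ), ∀ q : Fin m → ℤ, q ≠ 0 →
    ∃ j : Fin n, ε ≤ snorm q ^ ((m : ℝ) * k j) * dni (∑ i, (q i : ℝ) * L j i)

/-- The twisted set `Bad_L(k, n, m) ⊆ [0,1)^n`. -/
def badTwisted {n m : ℕ} (k : Fin n → ℝ) (L : Matrix (Fin n) (Fin m) ℝ) :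
    Set (Fin n → ℝ) :=
  {α | (∀ j, α j ∈ Set.Ico (0 : ℝ) 1) ∧ ∃ ε > (0 : ℝ), ∀ q : Fin m → ℤ, q ≠ 0 →
    ∃ j : Fin n, ε ≤ snorm q ^ ((m : ℝ) * k j) * dni ((∑ i, (q i : ℝ) * L j i) - α j)}

open MeasureTheory Filter Topology Set
open scoped ENNReal NNReal

/-- Slicing: if all fibres have positive `s`-measure then the set has positive `s+n` measure. -/
lemma slicing_lemma {n : ℕ} (s : ℝ) (hs : 0 < s) (E : Set (Fin (n+1) → ℝ))
    (hE : ∀ y : Fin n → ℝ, (∀ i, y i ∈ Set.Ico (0:ℝ) 1) →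
      Measure.hausdorffMeasure s {x : ℝ | (Fin.cons x y : Fin (n+1) → ℝ) ∈ E} ≠ 0) :
    Measure.hausdorffMeasure (s + n) E ≠ 0 := by
  intro h0
  have key : ∀ k : ℕ, ∃ U : ℕ → Set (Fin (n+1) → ℝ), E ⊆ ⋃ i, U i ∧
      (∀ i, Metric.ediam (U i) ≤ ((k:ℝ≥0∞) + 1)⁻¹) ∧
      ∑' i, ⨆ _ : (U i).Nonempty, Metric.ediam (U i) ^ (s + n) < (2⁻¹ : ℝ≥0∞) ^ k := by
    intro k
    rw [Measure.hausdorffMeasure_apply] at h0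
    have h1 := (iSup₂_eq_bot.1 h0) ((k:ℝ≥0∞) + 1)⁻¹ (by simp)
    have h2 : (⊥ : ℝ≥0∞) < (2⁻¹ : ℝ≥0∞) ^ k := by
      simp [pos_iff_ne_zero]
    rw [← h1] at h2
    simp only [iInf_lt_iff] at h2
    obtain ⟨U, hU, hd, hlt⟩ := h2
    exact ⟨U, hU, hd, hlt⟩
  choose U hU hd hsum using key
  have hlip : LipschitzWith 1 (Fin.tail : (Fin (n+1) → ℝ) → (Fin n → ℝ)) := by
    apply LipschitzWith.of_edist_le
    intro x y
    rw [edist_pi_le_iff]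
    intro i
    exact edist_le_pi_edist x y i.succ
  let B : ℕ → ℕ → Set (Fin n → ℝ) := fun k i => closure (Fin.tail '' (U k i))
  let g : ℕ → (Fin n → ℝ) → ℝ≥0∞ := fun k y =>
    ∑' i, (B k i).indicator (fun _ => Metric.ediam (U k i) ^ s) y
  have hBm : ∀ k i, MeasurableSet (B k i) := fun k i => isClosed_closure.measurableSet
  have hgm : ∀ k, Measurable (g k) := by
    intro k
    exact Measurable.tsum (fun i => measurable_const.indicator (hBm k i))
  have hgi : ∀ k, ∫⁻ y, g k y ≤ (2⁻¹ : ℝ≥0∞) ^ k := by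
    intro k
    refine le_trans ?_ (hsum k).le
    rw [lintegral_tsum (fun i => (measurable_const.indicator (hBm k i)).aemeasurable)]
    refine ENNReal.tsum_le_tsum fun i => ?_
    rw [lintegral_indicator_const (hBm k i)]
    by_cases hne : (U k i).Nonempty
    · simp only [hne, iSup_pos]
      have hv : volume (B k i) ≤ Metric.ediam (U k i) ^ n := by
        refine (Real.volume_pi_le_diam_pow _).trans ?_
        rw [Fintype.card_fin]
        gcongr
        rw [Metric.ediam_closure]
        simpa using hlip.ediam_image_le (U k i)
      calc _ ≤ Metric.ediam (U k i) ^ s * Metric.ediam (U k i) ^ n := by gcongr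
        _ = _ := by
          rw [ENNReal.rpow_add_of_nonneg _ _ hs.le (by positivity), ENNReal.rpow_natCast]
    · rw [Set.not_nonempty_iff_eq_empty] at hne
      simp [B, hne]
  have hfin : ∫⁻ y, ∑' k, g k y ≠ ∞ := by
    rw [lintegral_tsum (fun k => (hgm k).aemeasurable)]
    refine ne_top_of_le_ne_top ?_ (ENNReal.tsum_le_tsum hgi)
    rw [ENNReal.tsum_geometric]
    simp
  have hae : ∀ᵐ y : Fin n → ℝ, ∑' k, g k y < ∞ :=
    ae_lt_top (Measurable.tsum hgm) hfin
  obtain ⟨y, hy, hyI⟩ : ∃ y : Fin n → ℝ, ∑' k, g k y < ∞ ∧ ∀ i, y i ∈ Set.Ico (0:ℝ) 1 := by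
    by_contra hcon
    push Not at hcon
    have hz : volume (Set.univ.pi fun _ : Fin n => Set.Ico (0:ℝ) 1) = 0 := by
      refine measure_mono_null ?_ hae
      intro y hy
      simp only [Set.mem_compl_iff, Set.mem_ofPred_eq]
      intro hlt
      obtain ⟨i, hi⟩ := hcon y hlt
      exact hi (hy i (Set.mem_univ i))
    rw [volume_pi, Measure.pi_pi] at hz
    simp at hz
  refine hE y hyI ?_
  have htend : Tendsto (fun k => g k y) atTop (𝓝 0) :=
    ENNReal.tendsto_atTop_zero_of_tsum_ne_top hy.ne
  let V : ℕ → ℕ → Set ℝ := fun k i => {x | (Fin.cons x y : Fin (n+1) → ℝ) ∈ U k i}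
  have hVd : ∀ k i, Metric.ediam (V k i) ≤ Metric.ediam (U k i) := by
    intro k i
    refine Metric.ediam_le fun a ha b hb => ?_
    refine le_trans ?_ (Metric.edist_le_ediam_of_mem ha hb)
    simpa using edist_le_pi_edist (Fin.cons a y : Fin (n+1) → ℝ) (Fin.cons b y) 0
  have hle := Measure.hausdorffMeasure_le_liminf_tsum (ι := fun _ : ℕ => ℕ) s
    {x : ℝ | (Fin.cons x y : Fin (n+1) → ℝ) ∈ E} (l := atTop)
    (fun k : ℕ => ((k:ℝ≥0∞) + 1)⁻¹) (by
      have := (tendsto_add_atTop_iff_nat 1).2 ENNReal.tendsto_inv_nat_nhds_zero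
      simpa using this) V
    (Eventually.of_forall fun k i => (hVd k i).trans (hd k i))
    (Eventually.of_forall fun k x hx => by
      obtain ⟨i, hi⟩ := Set.mem_iUnion.1 (hU k hx)
      exact Set.mem_iUnion.2 ⟨i, hi⟩)
  refine le_antisymm (hle.trans ?_) (zero_le)
  rw [← htend.liminf_eq]
  refine liminf_le_liminf (Eventually.of_forall fun k => ENNReal.tsum_le_tsum fun i => ?_)
  by_cases hne : (V k i).Nonempty
  · obtain ⟨x, hx⟩ := hne
    have : y ∈ B k i := subset_closure ⟨_, hx, by simp⟩
    rw [Set.indicator_of_mem this]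
    exact ENNReal.rpow_le_rpow (hVd k i) hs.le
  · rw [Set.not_nonempty_iff_eq_empty] at hne
    simp [hne, hs]
lemma cantor_step (N : ℕ) (w a : ℝ) (hw : 0 < w) (D : Set ℝ)
    (hD : ∀ d ∈ D, ∀ e ∈ D, d ≠ e → 2 * ((2 * N + 1) * w) < |d - e|) :
    ∃ p : Fin N → ℕ, (∀ d d', d < d' → p d + 2 ≤ p d') ∧ (∀ d, p d + 1 ≤ 2 * N + 1) ∧
      ∀ d, ∀ e ∈ D, ∀ x, a + p d * w ≤ x → x ≤ a + (p d + 1) * w → w / 2 ≤ |x - e| := by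
  have hNw : 0 ≤ (N:ℝ) * w := by positivity
  have hrange : ∀ p : ℕ, p + 1 ≤ 2 * N + 1 → ∀ x, a + p * w ≤ x → x ≤ a + (p + 1) * w →
      a ≤ x ∧ x ≤ a + (2 * N + 1) * w := by
    intro p hp x h1 h2
    have : ((p:ℝ) + 1) ≤ 2 * N + 1 := by exact_mod_cast hp
    have h3 : ((p:ℝ) + 1) * w ≤ (2 * N + 1) * w := by gcongr
    have h4 : 0 ≤ (p:ℝ) * w := by positivity
    constructor <;> linarith
  by_cases h : ∃ e ∈ D, a - w / 2 < e ∧ e < a + (2 * N + 1) * w + w / 2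
  · obtain ⟨e, he, he1, he2⟩ := h
    have hp1 : ∀ d : Fin N, (if a + (2 * (d:ℕ) + 1) * w ≤ e - w / 2 then 2 * (d:ℕ) else 2 * d + 2) + 1
        ≤ 2 * N + 1 := by
      intro d
      have := d.2
      split_ifs <;> omega
    refine ⟨fun d => if a + (2 * (d:ℕ) + 1) * w ≤ e - w / 2 then 2 * (d:ℕ) else 2 * d + 2, ?_, hp1, ?_⟩
    · intro d d' hdd
      have hlt : (d:ℕ) < d' := hdd
      by_cases h1 : a + (2 * (d:ℕ) + 1) * w ≤ e - w / 2
      · simp only [h1, if_true]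
        split_ifs <;> omega
      · have h2 : ¬ a + (2 * (d':ℕ) + 1) * w ≤ e - w / 2 := by
          intro h2
          apply h1
          refine le_trans ?_ h2
          have : ((d:ℕ):ℝ) ≤ (d':ℕ) := by exact_mod_cast hlt.le
          gcongr
        simp only [h1, h2, if_false]
        omega
    · intro d e' he' x hx1 hx2
      obtain ⟨hx3, hx4⟩ := hrange _ (hp1 d) x hx1 hx2
      by_cases hee : e' = e
      · subst hee
        by_cases h1 : a + (2 * (d:ℕ) + 1) * w ≤ e' - w / 2
        · simp only [h1, if_true] at hx2
          push_cast at hx2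
          rw [abs_sub_comm]
          refine le_trans ?_ (le_abs_self _)
          linarith
        · simp only [h1, if_false] at hx1
          push_cast at hx1
          refine le_trans ?_ (le_abs_self _)
          rw [not_le] at h1
          linarith
      · have := hD e' he' e he hee
        by_contra hcon
        rw [not_le, abs_lt] at hcon
        rw [lt_abs] at this
        rcases this with h | h <;> linarith
  · push Not at h
    refine ⟨fun d => 2 * (d:ℕ), ?_, ?_, ?_⟩
    · intro d d' hdd
      have hlt : (d:ℕ) < d' := hdd
      simp only
      omega
    · intro d
      have := d.2
      simp only
      omega
    · intro d e he x hx1 hx2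
      have hd := d.2
      obtain ⟨hx3, hx4⟩ := hrange (2 * (d:ℕ)) (by omega) x hx1 hx2
      by_contra hcon
      rw [not_le, abs_lt] at hcon
      have := h e he (by linarith)
      linarith

lemma cantor_dim (s : ℝ≥0) (hs : 0 < s) (N : ℕ) (hN : 2 ≤ N)
    (hMs : (2 * N + 1 : ℝ) ^ (s : ℝ) ≤ N) (l : ℝ) (hl : 0 < l) (D : ℕ → Set ℝ)
    (hD : ∀ t, ∀ d ∈ D t, ∀ e ∈ D t, d ≠ e → 2 * (l / (2 * N + 1) ^ t) < |d - e|) :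
    (s : ℝ≥0∞) ≤ dimH {x : ℝ | 0 ≤ x ∧ x ≤ l ∧
      ∀ t, ∀ d ∈ D t, l / (2 * N + 1) ^ (t + 1) / 2 ≤ |x - d|} := by
  set M : ℝ := 2 * N + 1 with hM
  have hN0 : (2:ℝ) ≤ N := by exact_mod_cast hN
  have hM0 : 0 < M := by positivity
  have hM1 : 1 < M := by linarith
  have hw : ∀ t : ℕ, 0 < l / M ^ t := fun t => by positivity
  have hMw : ∀ t : ℕ, M * (l / M ^ (t + 1)) = l / M ^ t := fun t => by
    field_simp
    ring
  have hex : ∀ (t : ℕ) (a : ℝ), _ := fun t a => cantor_step N (l / M ^ (t + 1)) a (hw _) (D t)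
    (by rw [← hM, hMw]; exact hD t)
  choose p hp1 hp2 hp3 using hex
  let A : (ℕ → Fin N) → ℕ → ℝ := fun ω t =>
    Nat.rec 0 (fun t a => a + p t a (ω t) * (l / M ^ (t + 1))) t
  have hA0 : ∀ ω, A ω 0 = 0 := fun ω => rfl
  have hAs : ∀ ω t, A ω (t + 1) = A ω t + p t (A ω t) (ω t) * (l / M ^ (t + 1)) := fun ω t => rfl
  have hAmono : ∀ ω, Monotone (A ω) := by
    intro ω
    refine monotone_nat_of_le_succ fun t => ?_
    rw [hAs]
    have := hw (t + 1)
    have : 0 ≤ (p t (A ω t) (ω t) : ℝ) * (l / M ^ (t + 1)) := by positivity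
    linarith
  have hBanti : ∀ ω, Antitone (fun t => A ω t + l / M ^ t) := by
    intro ω
    refine antitone_nat_of_succ_le fun t => ?_
    rw [hAs, ← hMw t]
    have h1 := hw (t + 1)
    have h2 : (p t (A ω t) (ω t) : ℝ) + 1 ≤ M := by
      rw [hM]; exact_mod_cast hp2 t (A ω t) (ω t)
    have := mul_le_mul_of_nonneg_right h2 h1.le
    linarith
  have hAB : ∀ ω t u, A ω t ≤ A ω u + l / M ^ u := by
    intro ω t u
    calc A ω t ≤ A ω (max t u) := hAmono ω (le_max_left _ _)
      _ ≤ A ω (max t u) + l / M ^ (max t u) := by linarith [hw (max t u)]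
      _ ≤ _ := hBanti ω (le_max_right _ _)
  let φ : (ℕ → Fin N) → ℝ := fun ω => ⨆ t, A ω t
  have hφ1 : ∀ ω t, A ω t ≤ φ ω := fun ω t =>
    le_ciSup ⟨A ω 0 + l / M ^ 0, by rintro _ ⟨u, rfl⟩; exact hAB ω u 0⟩ t
  have hφ2 : ∀ ω t, φ ω ≤ A ω t + l / M ^ t := fun ω t => ciSup_le fun u => hAB ω u t
  have hagree : ∀ ω ω' : ℕ → Fin N, ∀ t, (∀ i < t, ω i = ω' i) → A ω t = A ω' t := by
    intro ω ω' t
    induction t with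
    | zero => intro _; rfl
    | succ t ih =>
      intro h
      rw [hAs, hAs, ih (fun i hi => h i (by omega)), h t (by omega)]
  have hgap : ∀ ω ω' : ℕ → Fin N, ∀ t, (∀ i < t, ω i = ω' i) → ω t < ω' t →
      l / M ^ (t + 1) ≤ φ ω' - φ ω := by
    intro ω ω' t h hlt
    have h1 := hφ2 ω (t + 1)
    have h2 := hφ1 ω' (t + 1)
    rw [hAs] at h1 h2
    rw [← hagree ω ω' t h] at h2
    have h3 : (p t (A ω t) (ω t) : ℝ) + 2 ≤ p t (A ω t) (ω' t) := by
      exact_mod_cast hp1 t (A ω t) _ _ hlt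
    have := mul_le_mul_of_nonneg_right h3 (hw (t + 1)).le
    linarith
  -- Hölder inequality
  have hpow : ∀ t : ℕ, ((N:ℝ) ^ t)⁻¹ ≤ (M / l) ^ (s:ℝ) * (l / M ^ (t + 1)) ^ (s:ℝ) := by
    intro t
    rw [← Real.mul_rpow (by positivity) (by positivity)]
    have : M / l * (l / M ^ (t + 1)) = (M ^ t)⁻¹ := by
      field_simp
      ring
    rw [this, Real.inv_rpow (by positivity)]
    apply inv_anti₀ (by positivity)
    rw [← Real.rpow_natCast, ← Real.rpow_mul hM0.le, mul_comm, Real.rpow_mul hM0.le,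
      Real.rpow_natCast]
    gcongr
  have hholder : ∀ ω ω' : ℕ → Fin N, |Real.ofDigits ω - Real.ofDigits ω'| ≤
      (M / l) ^ (s:ℝ) * |φ ω - φ ω'| ^ (s:ℝ) := by
    intro ω ω'
    by_cases hne : ω = ω'
    · subst hne
      simp only [sub_self, abs_zero]
      positivity
    · have hex : ∃ t, ω t ≠ ω' t := Function.ne_iff.1 hne
      classical
      have hspec := Nat.find_spec hex
      have hmin : ∀ i < Nat.find hex, ω i = ω' i := fun i hi => by
        simpa using Nat.find_min hex hi
      refine (Real.abs_ofDigits_sub_ofDigits_le hmin).trans ((hpow _).trans ?_)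
      gcongr
      rcases lt_or_gt_of_ne hspec with h | h
      · rw [abs_sub_comm]
        exact (hgap ω ω' _ hmin h).trans (le_abs_self _)
      · exact (hgap ω' ω _ (fun i hi => (hmin i hi).symm) h).trans (le_abs_self _)
  have hsub : range φ ⊆ {x : ℝ | 0 ≤ x ∧ x ≤ l ∧
      ∀ t, ∀ d ∈ D t, l / M ^ (t + 1) / 2 ≤ |x - d|} := by
    rintro _ ⟨ω, rfl⟩
    refine ⟨by simpa [hA0] using hφ1 ω 0, by simpa [hA0] using hφ2 ω 0, fun t d hd => ?_⟩
    refine hp3 t (A ω t) (ω t) d hd _ ?_ ?_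
    · simpa [hAs] using hφ1 ω (t + 1)
    · have := hφ2 ω (t + 1)
      rw [hAs] at this
      linarith
  refine le_trans ?_ (dimH_mono hsub)
  have : Nonempty (ℕ → Fin N) := ⟨fun _ => ⟨0, by omega⟩⟩
  let f : ℝ → ℝ := fun x => Real.ofDigits (Function.invFun φ x)
  have hfH : HolderOnWith (Real.toNNReal ((M / l) ^ (s:ℝ))) s f (range φ) := by
    intro x hx y hy
    have h := hholder (Function.invFun φ x) (Function.invFun φ y)
    rw [Function.invFun_eq hx, Function.invFun_eq hy] at h
    rw [edist_dist, edist_dist, Real.dist_eq, Real.dist_eq]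
    rw [ENNReal.ofReal_rpow_of_nonneg (abs_nonneg _) (NNReal.coe_nonneg s)]
    change _ ≤ ENNReal.ofReal _ * _
    rw [← ENNReal.ofReal_mul (by positivity)]
    exact ENNReal.ofReal_le_ofReal h
  have him : Icc (0:ℝ) 1 ⊆ f '' range φ := by
    intro y hy
    obtain ⟨ω, -, rfl⟩ := Real.ofDigits_SurjOn (b := N) (by omega) hy
    refine ⟨φ ω, ⟨ω, rfl⟩, ?_⟩
    have h := hholder (Function.invFun φ (φ ω)) ω
    rw [Function.invFun_eq (f := φ) ⟨ω, rfl⟩] at h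
    rw [sub_self, abs_zero, Real.zero_rpow (by exact_mod_cast hs.ne'), mul_zero] at h
    exact sub_eq_zero.1 (abs_nonpos_iff.1 h)
  have h1 : (1 : ℝ≥0∞) ≤ dimH (range φ) / s := by
    refine le_trans ?_ ((dimH_mono him).trans (hfH.dimH_image_le hs))
    rw [Real.dimH_of_nonempty_interior (by simp)]
    simp
  rw [ENNReal.le_div_iff_mul_le (by simp [hs.ne']) (by simp)] at h1
  simpa using h1

lemma dni_le (x : ℝ) (z : ℤ) : dni x ≤ |x - z| := round_le x z

lemma dni_nonneg (x : ℝ) : 0 ≤ dni x := abs_nonneg _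

lemma dni_sub_le (a b c : ℝ) : dni (a - b) ≤ dni (a - c) + dni (b - c) := by
  refine (dni_le (a - b) (round (a - c) - round (b - c))).trans ?_
  unfold dni
  push_cast
  have : a - b - ((round (a - c) : ℝ) - round (b - c))
      = (a - c - round (a - c)) - (b - c - round (b - c)) := by ring
  rw [this]
  exact abs_sub _ _

lemma abs_le_snorm {d : ℕ} (q : Fin d → ℤ) (i : Fin d) : |(q i : ℝ)| ≤ snorm q :=
  le_ciSup (f := fun i => |(q i : ℝ)|) (Set.finite_range _).bddAbove i

lemma one_le_snorm {d : ℕ} (q : Fin d → ℤ) (hq : q ≠ 0) : 1 ≤ snorm q := by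
  obtain ⟨i, hi⟩ := Function.ne_iff.1 hq
  refine le_trans ?_ (abs_le_snorm q i)
  exact_mod_cast Int.one_le_abs hi

lemma snorm_sub_le {d : ℕ} (hd : 0 < d) (q r : Fin d → ℤ) : snorm (q - r) ≤ snorm q + snorm r := by
  have : Nonempty (Fin d) := ⟨⟨0, hd⟩⟩
  refine ciSup_le fun i => ?_
  simp only [Pi.sub_apply]
  push_cast
  exact (abs_sub _ _).trans (add_le_add (abs_le_snorm q i) (abs_le_snorm r i))

lemma exists_branching (s : ℝ) (hs0 : 0 < s) (hs : s < 1) :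
    ∃ N : ℕ, 2 ≤ N ∧ (2 * N + 1 : ℝ) ^ s ≤ N := by
  obtain ⟨N, hN⟩ := exists_nat_ge (max 2 ((3:ℝ) ^ (s / (1 - s))))
  have hN2 : (2:ℝ) ≤ N := (le_max_left _ _).trans hN
  have hN3 : (3:ℝ) ^ (s / (1 - s)) ≤ N := (le_max_right _ _).trans hN
  have hN0 : (0:ℝ) < N := by linarith
  refine ⟨N, by exact_mod_cast hN2, ?_⟩
  have h1s : 0 < 1 - s := by linarith
  have h3 : (3:ℝ) ^ s ≤ (N:ℝ) ^ (1 - s) := by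
    have := Real.rpow_le_rpow (by positivity) hN3 h1s.le
    rwa [← Real.rpow_mul (by norm_num), div_mul_cancel₀ _ h1s.ne'] at this
  calc (2 * N + 1 : ℝ) ^ s ≤ (3 * N : ℝ) ^ s := by
        apply Real.rpow_le_rpow (by positivity) (by linarith) hs0.le
    _ = 3 ^ s * (N:ℝ) ^ s := Real.mul_rpow (by norm_num) hN0.le
    _ ≤ (N:ℝ) ^ (1 - s) * (N:ℝ) ^ s := by gcongr
    _ = N := by rw [← Real.rpow_add hN0]; simp

lemma fiber_dim {n m : ℕ} (hm : 0 < m) (k : Fin (n + 1) → ℝ) (hk : ∀ j, 0 < k j)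
    (hksum : ∑ j, k j = 1) (L : Matrix (Fin (n + 1)) (Fin m) ℝ) (hL : badForm k L)
    (s : ℝ≥0) (hs0 : 0 < s) (hs1 : s < 1) (y : Fin n → ℝ)
    (hy : ∀ i, y i ∈ Set.Ico (0:ℝ) 1) :
    (s : ℝ≥0∞) ≤ dimH {x : ℝ | (Fin.cons x y : Fin (n+1) → ℝ) ∈ badTwisted k L} := by
  obtain ⟨N, hN2, hNs⟩ := exists_branching s (by exact_mod_cast hs0) (by exact_mod_cast hs1)
  obtain ⟨ε, hε, hbad⟩ := hL
  have hk1 : ∀ j, k j ≤ 1 := fun j => by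
    rw [← hksum]
    exact Finset.single_le_sum (fun i _ => (hk i).le) (Finset.mem_univ j)
  have hm0 : (0:ℝ) < m := by exact_mod_cast hm
  set M : ℝ := 2 * N + 1 with hM
  have hN0 : (2:ℝ) ≤ N := by exact_mod_cast hN2
  have hM1 : 1 < M := by linarith
  have hM0 : 0 < M := by linarith
  have hκ : ∀ j, 0 < (m:ℝ) * k j := fun j => mul_pos hm0 (hk j)
  have hκm : ∀ j, (m:ℝ) * k j ≤ m := fun j => by
    have := mul_le_mul_of_nonneg_left (hk1 j) hm0.le
    linarith
  set a : ℝ := (m:ℝ) * k 0 with ha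
  have ha0 : 0 < a := hκ 0
  set G : ℝ := M ^ (1 / a) with hG
  have hG1 : 1 < G := Real.one_lt_rpow hM1 (by positivity)
  have hG0 : 0 < G := by linarith
  have hGt : ∀ t : ℕ, (G ^ t) ^ a = M ^ t := by
    intro t
    rw [hG, ← Real.rpow_natCast, ← Real.rpow_mul hM0.le, ← Real.rpow_mul hM0.le,
      ← Real.rpow_natCast]
    congr 1
    field_simp
  set K : ℝ := (2 * G) ^ (m:ℝ) with hK
  have hK0 : 0 < K := by positivity
  have hKj : ∀ j, (2 * G) ^ ((m:ℝ) * k j) ≤ K := fun j =>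
    Real.rpow_le_rpow_of_exponent_le (by linarith) (hκm j)
  set δ : ℝ := ε / (4 * K) with hδ
  have hδ0 : 0 < δ := by positivity
  set l : ℝ := min (ε / K) 1 / 4 with hl
  have hl0 : 0 < l := by positivity
  have hl1 : 4 * l ≤ ε / K := by
    have := min_le_left (ε / K) 1
    linarith
  have hl2 : 4 * l ≤ 1 := by
    have := min_le_right (ε / K) 1
    linarith
  let F : Fin (n + 1) → (Fin m → ℤ) → ℝ := fun j q => ∑ i, (q i : ℝ) * L j i
  have hFsub : ∀ j q r, F j (q - r) = F j q - F j r := by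
    intro j q r
    simp only [F, Pi.sub_apply, Int.cast_sub, sub_mul, Finset.sum_sub_distrib]
  let D : ℕ → Set ℝ := fun t => {d | ∃ q : Fin m → ℤ, ∃ z : ℤ, d = F 0 q - z ∧ G ^ t ≤ snorm q ∧
    snorm q < G ^ (t + 1) ∧ ∀ j : Fin n, snorm q ^ ((m:ℝ) * k j.succ) *
      dni (F j.succ q - y j) < δ}
  have hD : ∀ t, ∀ d ∈ D t, ∀ e ∈ D t, d ≠ e → 2 * (l / M ^ t) < |d - e| := by
    rintro t d ⟨q, z, rfl, hq1, hq2, hq3⟩ e ⟨r, w, rfl, hr1, hr2, hr3⟩ hne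
    have hMt : 1 ≤ M ^ t := one_le_pow₀ hM1.le
    have hGt0 : 0 < G ^ t := by positivity
    by_cases hqr : q = r
    · subst hqr
      have hzw : z ≠ w := by rintro rfl; exact hne rfl
      have h1 : (1:ℝ) ≤ |(w:ℝ) - z| := by
        exact_mod_cast Int.one_le_abs (sub_ne_zero.2 hzw.symm)
      have h2 : l / M ^ t ≤ l := div_le_self hl0.le hMt
      have h3 : F 0 q - z - (F 0 q - w) = (w:ℝ) - z := by ring
      rw [h3]
      linarith
    · have hqr0 : q - r ≠ 0 := sub_ne_zero.2 hqr
      have hsn : snorm (q - r) ≤ 2 * G * G ^ t := by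
        have := snorm_sub_le hm q r
        rw [pow_succ] at hq2 hr2
        linarith
      obtain ⟨j, hj⟩ := hbad (q - r) hqr0
      change ε ≤ snorm (q - r) ^ ((m:ℝ) * k j) * dni (F j (q - r)) at hj
      rw [hFsub] at hj
      have hj2 : ε ≤ K * ((G ^ t) ^ ((m:ℝ) * k j) * dni (F j q - F j r)) := by
        refine hj.trans ?_
        rw [← mul_assoc]
        refine mul_le_mul_of_nonneg_right ?_ (dni_nonneg _)
        have h0 : 0 ≤ snorm (q - r) := by linarith [one_le_snorm _ hqr0]
        calc snorm (q - r) ^ ((m:ℝ) * k j) ≤ (2 * G * G ^ t) ^ ((m:ℝ) * k j) :=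
              Real.rpow_le_rpow h0 hsn (hκ j).le
          _ = (2 * G) ^ ((m:ℝ) * k j) * (G ^ t) ^ ((m:ℝ) * k j) :=
              Real.mul_rpow (by positivity) hGt0.le
          _ ≤ _ := mul_le_mul_of_nonneg_right (hKj j) (by positivity)
      have hj3 : 4 * l ≤ (G ^ t) ^ ((m:ℝ) * k j) * dni (F j q - F j r) := by
        refine hl1.trans ?_
        rw [div_le_iff₀ hK0]
        linarith
      have hj4 : 4 * δ ≤ (G ^ t) ^ ((m:ℝ) * k j) * dni (F j q - F j r) := by
        have : 4 * δ = ε / K := by rw [hδ]; field_simp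
        rw [this, div_le_iff₀ hK0]
        linarith
      induction j using Fin.cases with
      | zero =>
        rw [← ha, hGt] at hj3
        have h1 : dni (F 0 q - F 0 r) ≤ |F 0 q - z - (F 0 r - w)| := by
          have := dni_le (F 0 q - F 0 r) (z - w)
          push_cast at this
          convert this using 2
          ring
        have h2 : 4 * (l / M ^ t) ≤ dni (F 0 q - F 0 r) := by
          rw [← mul_div_assoc, div_le_iff₀ (by positivity)]
          linarith
        have h3 : 0 < l / M ^ t := by positivity
        linarith
      | succ j =>
        exfalso
        have hX : ∀ u : Fin m → ℤ, G ^ t ≤ snorm u →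
            snorm u ^ ((m:ℝ) * k j.succ) * dni (F j.succ u - y j) < δ →
            (G ^ t) ^ ((m:ℝ) * k j.succ) * dni (F j.succ u - y j) < δ := by
          intro u hu1 hu2
          refine lt_of_le_of_lt ?_ hu2
          refine mul_le_mul_of_nonneg_right ?_ (dni_nonneg _)
          exact Real.rpow_le_rpow hGt0.le hu1 (hκ _).le
        have h1 := hX q hq1 (hq3 j)
        have h2 := hX r hr1 (hr3 j)
        have h3 := mul_le_mul_of_nonneg_left (dni_sub_le (F j.succ q) (F j.succ r) (y j))
          (show 0 ≤ (G ^ t) ^ ((m:ℝ) * k j.succ) by positivity)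
        rw [mul_add] at h3
        linarith
  refine (cantor_dim s hs0 N hN2 hNs l hl0 D hD).trans (dimH_mono ?_)
  rintro x ⟨hx0, hxl, hx⟩
  refine ⟨?_, min δ (l / M / 2), by positivity, ?_⟩
  · intro j
    induction j using Fin.cases with
    | zero =>
      rw [Fin.cons_zero]
      exact ⟨hx0, by linarith⟩
    | succ j =>
      rw [Fin.cons_succ]
      exact hy j
  · intro q hq
    by_cases hex : ∃ j : Fin n, δ ≤ snorm q ^ ((m:ℝ) * k j.succ) * dni (F j.succ q - y j)
    · obtain ⟨j, hj⟩ := hex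
      refine ⟨j.succ, (min_le_left _ _).trans ?_⟩
      rw [Fin.cons_succ]
      exact hj
    · push Not at hex
      refine ⟨0, (min_le_right _ _).trans ?_⟩
      rw [Fin.cons_zero]
      obtain ⟨t, ht1, ht2⟩ := exists_nat_pow_near (one_le_snorm q hq) hG1
      have h1 := hx t (F 0 q - round (F 0 q - x)) ⟨q, _, rfl, ht1, ht2, hex⟩
      have h2 : |x - (F 0 q - round (F 0 q - x))| = dni (F 0 q - x) := by
        rw [abs_sub_comm, dni]
        congr 1
        ring
      rw [h2] at h1
      change _ ≤ snorm q ^ a * dni (F 0 q - x)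
      have h3 : M ^ t ≤ snorm q ^ a := by
        rw [← hGt]
        exact Real.rpow_le_rpow (by positivity) ht1 ha0.le
      calc l / M / 2 = M ^ t * (l / M ^ (t + 1) / 2) := by
            field_simp
            ring
        _ ≤ snorm q ^ a * dni (F 0 q - x) := by
            refine mul_le_mul h3 h1 (by positivity) ?_
            exact (by positivity : (0:ℝ) ≤ M ^ t).trans h3

/-- For any weight vector `k` and any `n × m` matrix
`L ∈ Bad(k,n,m)`, the set `Bad_L(k,n,m)` has full Hausdorff dimension `n`. -/
theorem badTwisted_dimH_eq (n m : ℕ) (hn : 0 < n) (hm : 0 < m)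
    (k : Fin n → ℝ) (hk : ∀ j, 0 < k j) (hksum : ∑ j, k j = 1)
    (L : Matrix (Fin n) (Fin m) ℝ) (hL : badForm k L) :
    dimH (badTwisted k L) = n := by
  apply le_antisymm
  · rw [← Real.dimH_univ_pi_fin n]
    exact dimH_mono (Set.subset_univ _)
  · obtain ⟨n, rfl⟩ : ∃ n', n = n' + 1 := ⟨n - 1, by omega⟩
    have key : ∀ s : ℝ≥0, 0 < s → s < 1 → ((s + n : ℝ≥0) : ℝ≥0∞) ≤ dimH (badTwisted k L) := by
      intro s hs0 hs1
      obtain ⟨s', hs, hs'⟩ := exists_between hs1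
      refine le_dimH_of_hausdorffMeasure_ne_zero ?_
      have := slicing_lemma (s:ℝ) (by exact_mod_cast hs0) (badTwisted k L) (fun y hy => by
        have h1 := fiber_dim hm k hk hksum L hL s' (hs0.trans hs) hs' y hy
        have h2 : (s : ℝ≥0∞) < dimH {x : ℝ | (Fin.cons x y : Fin (n+1) → ℝ) ∈ badTwisted k L} :=
          lt_of_lt_of_le (by exact_mod_cast hs) h1
        rw [hausdorffMeasure_of_lt_dimH h2]
        simp)
      push_cast
      exact this
    refine le_of_forall_lt fun c hc => ?_
    lift c to ℝ≥0 using (hc.trans (by simp)).ne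
    have hc' : c < n + 1 := by exact_mod_cast hc
    have h1 : max (c - n) (1/2) < 1 := by
      rw [max_lt_iff]
      constructor
      · rcases le_total c (n : ℝ≥0) with h | h
        · rw [tsub_eq_zero_of_le h]
          exact zero_lt_one
        · rw [tsub_lt_iff_left h]
          exact hc'
      · norm_num
    obtain ⟨s, hs, hs1⟩ := exists_between h1
    rw [max_lt_iff] at hs
    refine lt_of_lt_of_le ?_ (key s (lt_trans (by norm_num) hs.2) hs1)
    have : c < s + n := lt_add_of_tsub_lt_right hs.1
    exact_mod_cast this
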